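/- arXiv:1705.07160 — 2 statements merged into one kernel-verified Lean document; each statement's English description precedes it below -/
import Mathlib

section
/- Let n, d ≥ 2 be integers and F = ℝ or ℂ. Then α'(n,d,F)·β'(n,d,F) = 1; moreover, for S ∈ S^d F^n with ‖S‖ = 1, one has ‖S‖_{1,F} = α'(n,d,F) if and only if ‖S‖_{∞,F} = β'(n,d,F). -/
noncomputable section


/-- The Euclidean norm of a vector in `𝕜^k`. -/
def vnorm {𝕜 : Type*} [RCLike 𝕜] {k : ℕ} (x : Fin k → 𝕜) : ℝ :=
  Real.sqrt (∑ i, ‖x i‖ ^ 2)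

/-- The rank-one tensor `x₁ ⊗ ⋯ ⊗ x_d` on `𝕜^n`. -/
def rankOne {𝕜 : Type*} [RCLike 𝕜] {d n : ℕ} (x : Fin d → Fin n → 𝕜) :
    (Fin d → Fin n) → 𝕜 :=
  fun i => ∏ j, x j (i j)

/-- The standard inner product `⟨T, Y⟩ = ∑ tᵢ · conj yᵢ` of tensors. -/
def tinner {𝕜 : Type*} [RCLike 𝕜] {d n : ℕ} (T Y : (Fin d → Fin n) → 𝕜) : 𝕜 :=
  ∑ i, T i * (starRingEnd 𝕜) (Y i)

/-- The Hilbert–Schmidt norm of a tensor. -/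
def hsNorm {𝕜 : Type*} [RCLike 𝕜] {d n : ℕ} (T : (Fin d → Fin n) → 𝕜) : ℝ :=
  Real.sqrt (∑ i, ‖T i‖ ^ 2)

/-- The spectral norm of a tensor:
`max {|⟨T, x₁⊗⋯⊗x_d⟩| : ‖x_j‖ = 1 for all j}`. -/
def specNorm {𝕜 : Type*} [RCLike 𝕜] {d n : ℕ} (T : (Fin d → Fin n) → 𝕜) : ℝ :=
  sSup {r : ℝ | ∃ x : Fin d → Fin n → 𝕜, (∀ j, vnorm (x j) = 1) ∧
    r = ‖tinner T (rankOne x)‖}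

/-- The nuclear norm of a tensor:
`min {∑ᵢ ∏ⱼ ‖x_{i,j}‖ : T = ∑ᵢ x_{i,1}⊗⋯⊗x_{i,d}}`. -/
def nucNorm {𝕜 : Type*} [RCLike 𝕜] {d n : ℕ} (T : (Fin d → Fin n) → 𝕜) : ℝ :=
  sInf {r : ℝ | ∃ (m : ℕ) (x : Fin m → Fin d → Fin n → 𝕜),
    T = (∑ i, rankOne (x i)) ∧ r = ∑ i, ∏ j, vnorm (x i j)}

/-- `α(n^{×d}, 𝕜)`. -/
def alphaN (𝕜 : Type*) [RCLike 𝕜] (d n : ℕ) : ℝ :=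
  sSup {r : ℝ | ∃ T : (Fin d → Fin n) → 𝕜, hsNorm T = 1 ∧ r = nucNorm T}

/-- `β(n^{×d}, 𝕜)`. -/
def betaN (𝕜 : Type*) [RCLike 𝕜] (d n : ℕ) : ℝ :=
  sInf {r : ℝ | ∃ T : (Fin d → Fin n) → 𝕜, hsNorm T = 1 ∧ r = specNorm T}

/-- A symmetric `d`-mode tensor on `𝕜^n`. -/
def IsSymT {𝕜 : Type*} [RCLike 𝕜] {d n : ℕ} (S : (Fin d → Fin n) → 𝕜) : Prop :=
  ∀ (ω : Equiv.Perm (Fin d)) (i : Fin d → Fin n), S (i ∘ ω) = S i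

/-- `α'(n,d,𝕜)`: the maximal nuclear norm of a symmetric tensor of Hilbert–Schmidt
norm one. -/
def alphaSym (𝕜 : Type*) [RCLike 𝕜] (n d : ℕ) : ℝ :=
  sSup {r : ℝ | ∃ S : (Fin d → Fin n) → 𝕜, IsSymT S ∧ hsNorm S = 1 ∧ r = nucNorm S}

/-- `β'(n,d,𝕜)`: the minimal spectral norm of a symmetric tensor of Hilbert–Schmidt
norm one. -/
def betaSym (𝕜 : Type*) [RCLike 𝕜] (n d : ℕ) : ℝ :=
  sInf {r : ℝ | ∃ S : (Fin d → Fin n) → 𝕜, IsSymT S ∧ hsNorm S = 1 ∧ r = specNorm S}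

section helpers

variable {𝕜 : Type*} [RCLike 𝕜] {d n : ℕ}

lemma vnorm_nonneg' (x : Fin n → 𝕜) : 0 ≤ vnorm x := Real.sqrt_nonneg _

lemma coord_le_vnorm (x : Fin n → 𝕜) (i : Fin n) : ‖x i‖ ≤ vnorm x := by
  apply Real.le_sqrt_of_sq_le
  exact Finset.single_le_sum (f := fun i => ‖x i‖ ^ 2) (fun _ _ => by positivity) (Finset.mem_univ i)

lemma vnorm_smul' (c : 𝕜) (x : Fin n → 𝕜) : vnorm (c • x) = ‖c‖ * vnorm x := by
  unfold vnorm
  simp only [Pi.smul_apply, smul_eq_mul, norm_mul, mul_pow]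
  rw [← Finset.mul_sum, Real.sqrt_mul (by positivity), Real.sqrt_sq (norm_nonneg _)]

lemma hsNorm_sq (T : (Fin d → Fin n) → 𝕜) : hsNorm T ^ 2 = ∑ i, ‖T i‖ ^ 2 :=
  Real.sq_sqrt (Finset.sum_nonneg fun _ _ => by positivity)

lemma hsNorm_nonneg' (T : (Fin d → Fin n) → 𝕜) : 0 ≤ hsNorm T := Real.sqrt_nonneg _

lemma spec_bdd (T : (Fin d → Fin n) → 𝕜) : BddAbove {r : ℝ | ∃ x : Fin d → Fin n → 𝕜, (∀ j, vnorm (x j) = 1) ∧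
    r = ‖tinner T (rankOne x)‖} := by
  refine ⟨∑ i, ‖T i‖, ?_⟩
  rintro r ⟨x, hx, rfl⟩
  unfold tinner rankOne
  refine (norm_sum_le _ _).trans (Finset.sum_le_sum fun i _ => ?_)
  rw [norm_mul, RCLike.norm_conj, norm_prod]
  refine mul_le_of_le_one_right (norm_nonneg _) (Finset.prod_le_one (fun _ _ => norm_nonneg _) fun j _ => ?_)
  exact (coord_le_vnorm _ _).trans (hx j).le

lemma le_spec (T : (Fin d → Fin n) → 𝕜) (x : Fin d → Fin n → 𝕜) (hx : ∀ j, vnorm (x j) = 1) :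
    ‖tinner T (rankOne x)‖ ≤ specNorm T := le_csSup (spec_bdd T) ⟨x, hx, rfl⟩

lemma spec_nonneg (T : (Fin d → Fin n) → 𝕜) : 0 ≤ specNorm T := by
  apply Real.sSup_nonneg
  rintro r ⟨x, _, rfl⟩
  exact norm_nonneg _

lemma spec_le (T : (Fin d → Fin n) → 𝕜) (b : ℝ) (hb : 0 ≤ b)
    (h : ∀ x : Fin d → Fin n → 𝕜, (∀ j, vnorm (x j) = 1) → ‖tinner T (rankOne x)‖ ≤ b) :
    specNorm T ≤ b := by
  apply Real.sSup_le _ hb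
  rintro r ⟨x, hx, rfl⟩
  exact h x hx

lemma rankOne_smul (c : Fin d → 𝕜) (x : Fin d → Fin n → 𝕜) :
    rankOne (fun j => c j • x j) = (∏ j, c j) • rankOne x := by
  funext i
  simp [rankOne, Finset.prod_mul_distrib]

lemma tinner_smul_right (T Y : (Fin d → Fin n) → 𝕜) (c : 𝕜) :
    tinner T (c • Y) = (starRingEnd 𝕜) c * tinner T Y := by
  simp only [tinner, Pi.smul_apply, smul_eq_mul, map_mul, Finset.mul_sum]
  exact Finset.sum_congr rfl fun _ _ => by ring

lemma tinner_smul_left (T Y : (Fin d → Fin n) → 𝕜) (c : 𝕜) :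
    tinner (c • T) Y = c * tinner T Y := by
  simp only [tinner, Pi.smul_apply, smul_eq_mul, Finset.mul_sum]
  exact Finset.sum_congr rfl fun _ _ => by ring

lemma tinner_conj (T Y : (Fin d → Fin n) → 𝕜) :
    (starRingEnd 𝕜) (tinner T Y) = tinner Y T := by
  simp only [tinner, map_sum, map_mul, RCLike.conj_conj]
  exact Finset.sum_congr rfl fun _ _ => by ring

lemma tinner_norm_comm (T Y : (Fin d → Fin n) → 𝕜) :
    ‖tinner T Y‖ = ‖tinner Y T‖ := by
  rw [← tinner_conj, RCLike.norm_conj]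

lemma tinner_sum_left {ι : Type*} (s : Finset ι) (f : ι → (Fin d → Fin n) → 𝕜) (Y : (Fin d → Fin n) → 𝕜) :
    tinner (∑ k ∈ s, f k) Y = ∑ k ∈ s, tinner (f k) Y := by
  simp only [tinner, Finset.sum_apply, Finset.sum_mul]
  exact Finset.sum_comm

lemma spec_smul_le (T : (Fin d → Fin n) → 𝕜) (c : 𝕜) : specNorm (c • T) ≤ ‖c‖ * specNorm T := by
  apply spec_le _ _ (mul_nonneg (norm_nonneg _) (spec_nonneg _))
  intro x hx
  rw [tinner_smul_left, norm_mul]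
  exact mul_le_mul_of_nonneg_left (le_spec T x hx) (norm_nonneg _)

lemma rank_one_bound (T : (Fin d → Fin n) → 𝕜) (x : Fin d → Fin n → 𝕜) :
    ‖tinner T (rankOne x)‖ ≤ (∏ j, vnorm (x j)) * specNorm T := by
  by_cases h : ∀ j, vnorm (x j) ≠ 0
  · have hx : x = fun j => ((vnorm (x j) : ℝ) : 𝕜) • (((vnorm (x j))⁻¹ : ℝ) : 𝕜) • x j := by
      funext j
      rw [smul_smul, ← RCLike.ofReal_mul, mul_inv_cancel₀ (h j)]
      simp
    conv_lhs => rw [hx]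
    rw [rankOne_smul, tinner_smul_right, norm_mul, RCLike.norm_conj, norm_prod]
    have : ∀ j, ‖((vnorm (x j) : ℝ) : 𝕜)‖ = vnorm (x j) := fun j => by
      rw [RCLike.norm_ofReal, abs_of_nonneg (vnorm_nonneg' _)]
    simp only [this]
    refine mul_le_mul_of_nonneg_left (le_spec T _ fun j => ?_) (Finset.prod_nonneg fun _ _ => vnorm_nonneg' _)
    rw [vnorm_smul', RCLike.norm_ofReal, abs_of_nonneg (inv_nonneg.2 (vnorm_nonneg' _)), inv_mul_cancel₀ (h j)]
  · push Not at h
    obtain ⟨j, hj⟩ := h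
    have : rankOne x = 0 := by
      funext i
      apply Finset.prod_eq_zero (Finset.mem_univ j)
      have := coord_le_vnorm (x j) (i j)
      rw [hj] at this
      exact norm_le_zero_iff.1 this
    rw [this]
    simp only [tinner, Pi.zero_apply, map_zero, mul_zero, Finset.sum_const_zero, norm_zero]
    exact mul_nonneg (Finset.prod_nonneg fun _ _ => vnorm_nonneg' _) (spec_nonneg _)

def nucSet (T : (Fin d → Fin n) → 𝕜) : Set ℝ := {r : ℝ | ∃ (m : ℕ) (x : Fin m → Fin d → Fin n → 𝕜),
    T = (∑ i, rankOne (x i)) ∧ r = ∑ i, ∏ j, vnorm (x i j)}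

lemma nuc_eq (T : (Fin d → Fin n) → 𝕜) : nucNorm T = sInf (nucSet T) := rfl

lemma nucSet_nonneg (T : (Fin d → Fin n) → 𝕜) : ∀ r ∈ nucSet T, 0 ≤ r := by
  rintro r ⟨m, x, -, rfl⟩
  exact Finset.sum_nonneg fun _ _ => Finset.prod_nonneg fun _ _ => vnorm_nonneg' _

lemma nucSet_bdd (T : (Fin d → Fin n) → 𝕜) : BddBelow (nucSet T) := ⟨0, nucSet_nonneg T⟩

/-- scaling weights concentrated at one mode -/
def wt (j0 : Fin d) (c : 𝕜) : Fin d → 𝕜 := fun j => if j = j0 then c else 1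

lemma prod_wt (j0 : Fin d) (c : 𝕜) : ∏ j, wt j0 c j = c := by simp [wt]

lemma prod_norm_wt (j0 : Fin d) (c : 𝕜) : ∏ j, ‖wt j0 c j‖ = ‖c‖ := by
  rw [← norm_prod, prod_wt]

lemma prod_vnorm_wt (j0 : Fin d) (c : 𝕜) (x : Fin d → Fin n → 𝕜) :
    ∏ j, vnorm (wt j0 c j • x j) = ‖c‖ * ∏ j, vnorm (x j) := by
  simp only [vnorm_smul', Finset.prod_mul_distrib, prod_norm_wt]

lemma vnorm_single (a : Fin n) : vnorm (Pi.single a (1 : 𝕜)) = 1 := by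
  unfold vnorm
  rw [Finset.sum_eq_single a]
  · simp
  · intro b _ hb; simp [hb]
  · simp

lemma rankOne_single (i : Fin d → Fin n) :
    rankOne (fun j => Pi.single (i j) (1 : 𝕜)) = Pi.single i 1 := by
  funext k
  by_cases h : k = i
  · subst h; simp [rankOne]
  · rw [Pi.single_eq_of_ne h]
    have : ∃ j, k j ≠ i j := by
      by_contra hc; push Not at hc; exact h (funext hc)
    obtain ⟨j, hj⟩ := this
    exact Finset.prod_eq_zero (Finset.mem_univ j) (by simp [hj])

lemma nucSet_sum_mem (j0 : Fin d) (T : (Fin d → Fin n) → 𝕜) : (∑ i, ‖T i‖) ∈ nucSet T := by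
  let e := Fintype.equivFin (Fin d → Fin n)
  refine ⟨Fintype.card (Fin d → Fin n), fun k j => wt j0 (T (e.symm k)) j • Pi.single ((e.symm k) j) (1 : 𝕜), ?_, ?_⟩
  · simp only [rankOne_smul, prod_wt, rankOne_single]
    rw [Equiv.sum_comp e.symm (fun i => T i • (Pi.single i (1 : 𝕜) : (Fin d → Fin n) → 𝕜))]
    funext k
    simp [Finset.sum_apply, Pi.single_apply]
  · simp only [prod_vnorm_wt, vnorm_single]
    rw [Equiv.sum_comp e.symm (fun i => ‖T i‖ * ∏ j : Fin d, (1:ℝ))]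
    simp

lemma nuc_le_sum (j0 : Fin d) (T : (Fin d → Fin n) → 𝕜) : nucNorm T ≤ ∑ i, ‖T i‖ :=
  csInf_le (nucSet_bdd T) (nucSet_sum_mem j0 T)

lemma nuc_nonneg (T : (Fin d → Fin n) → 𝕜) : 0 ≤ nucNorm T := Real.sInf_nonneg (nucSet_nonneg T)

lemma nuc_rankOne (x : Fin d → Fin n → 𝕜) : nucNorm (rankOne x) ≤ ∏ j, vnorm (x j) :=
  csInf_le (nucSet_bdd _) ⟨1, fun _ => x, by simp, by simp⟩

lemma nuc_add (j0 : Fin d) (S T : (Fin d → Fin n) → 𝕜) : nucNorm (S + T) ≤ nucNorm S + nucNorm T := by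
  apply le_of_forall_pos_lt_add
  intro ε hε
  obtain ⟨r, ⟨m, x, hx, rfl⟩, hr⟩ := exists_lt_of_csInf_lt (s := nucSet S) (b := nucNorm S + ε/2) ⟨_, nucSet_sum_mem j0 S⟩
    (by rw [nuc_eq]; linarith)
  obtain ⟨r, ⟨m', y, hy, rfl⟩, hr'⟩ := exists_lt_of_csInf_lt (s := nucSet T) (b := nucNorm T + ε/2) ⟨_, nucSet_sum_mem j0 T⟩
    (by rw [nuc_eq]; linarith)
  have : nucNorm (S + T) ≤ (∑ i, ∏ j, vnorm (x i j)) + ∑ i, ∏ j, vnorm (y i j) := by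
    apply csInf_le (nucSet_bdd _)
    refine ⟨m + m', Fin.append x y, ?_, ?_⟩
    · rw [Fin.sum_univ_add]; simp only [Fin.append_left, Fin.append_right]; rw [← hx, ← hy]
    · rw [Fin.sum_univ_add]; simp only [Fin.append_left, Fin.append_right]
  linarith

lemma nuc_smul_le (j0 : Fin d) (c : 𝕜) (T : (Fin d → Fin n) → 𝕜) :
    nucNorm (c • T) ≤ ‖c‖ * nucNorm T := by
  have key : ∀ r ∈ nucSet T, nucNorm (c • T) ≤ ‖c‖ * r := by
    rintro r ⟨m, x, hx, rfl⟩
    apply csInf_le (nucSet_bdd _)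
    refine ⟨m, fun k j => wt j0 c j • x k j, ?_, ?_⟩
    · simp only [rankOne_smul, prod_wt]
      rw [← Finset.smul_sum, ← hx]
    · simp only [prod_vnorm_wt, Finset.mul_sum]
  rcases eq_or_lt_of_le (norm_nonneg c) with h | h
  · have := key _ (nucSet_sum_mem j0 T)
    rw [← h] at this ⊢
    simpa using this
  · rw [← div_le_iff₀' h]
    refine le_csInf ⟨_, nucSet_sum_mem j0 T⟩ fun r hr => ?_
    rw [div_le_iff₀' h]
    exact key r hr

lemma nuc_smul_pos (j0 : Fin d) (c : ℝ) (hc : 0 < c) (T : (Fin d → Fin n) → 𝕜) :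
    nucNorm (c • T) = c * nucNorm T := by
  have h1 : ∀ (c : ℝ), 0 < c → ∀ T : (Fin d → Fin n) → 𝕜, nucNorm (c • T) ≤ c * nucNorm T := by
    intro c hc T
    have h := nuc_smul_le j0 (c : 𝕜) T
    rw [RCLike.norm_ofReal, abs_of_pos hc] at h
    have e : (c : 𝕜) • T = c • T := by
      funext i; simp [RCLike.real_smul_eq_coe_mul]
    rwa [e] at h
  apply le_antisymm (h1 c hc T)
  have := h1 c⁻¹ (inv_pos.2 hc) (c • T)
  rw [smul_smul, inv_mul_cancel₀ hc.ne', one_smul] at this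
  rwa [← le_div_iff₀' hc, div_eq_inv_mul]

lemma tinner_le_nuc_spec (j0 : Fin d) (S T : (Fin d → Fin n) → 𝕜) :
    ‖tinner S T‖ ≤ nucNorm S * specNorm T := by
  have key : ∀ r ∈ nucSet S, ‖tinner S T‖ ≤ r * specNorm T := by
    rintro r ⟨m, x, hx, rfl⟩
    conv_lhs => rw [hx]
    rw [tinner_sum_left, Finset.sum_mul]
    refine (norm_sum_le _ _).trans (Finset.sum_le_sum fun k _ => ?_)
    rw [tinner_norm_comm]
    exact rank_one_bound T (x k)
  rcases eq_or_lt_of_le (spec_nonneg T) with h | h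
  · have := key _ (nucSet_sum_mem j0 S)
    rw [← h] at this ⊢
    simpa using this
  · rw [← div_le_iff₀ h]
    refine le_csInf ⟨_, nucSet_sum_mem j0 S⟩ fun r hr => ?_
    rw [div_le_iff₀ h]
    exact key r hr

lemma tinner_self (S : (Fin d → Fin n) → 𝕜) : tinner S S = ((hsNorm S ^ 2 : ℝ) : 𝕜) := by
  rw [hsNorm_sq]
  simp only [tinner, RCLike.mul_conj]
  push_cast
  rfl

/-- Riesz representation of a real functional -/
lemma riesz (f : ((Fin d → Fin n) → 𝕜) →ₗ[ℝ] ℝ) :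
    ∃ T : (Fin d → Fin n) → 𝕜, ∀ X, f X = RCLike.re (tinner X T) := by
  refine ⟨fun i => ((f (Pi.single i 1) : ℝ) : 𝕜) + ((f (Pi.single i RCLike.I) : ℝ) : 𝕜) * RCLike.I, fun X => ?_⟩
  have hX : X = ∑ i, (RCLike.re (X i) • (Pi.single i (1:𝕜) : (Fin d → Fin n) → 𝕜)
      + RCLike.im (X i) • (Pi.single i (RCLike.I : 𝕜) : (Fin d → Fin n) → 𝕜)) := by
    funext k
    rw [Finset.sum_apply, Finset.sum_eq_single k]
    · simp only [Pi.add_apply, Pi.smul_apply, Pi.single_eq_same, RCLike.real_smul_eq_coe_mul, mul_one]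
      exact (RCLike.re_add_im _).symm
    · intro b _ hb
      simp [Pi.single_eq_of_ne hb.symm]
    · simp
  conv_lhs => rw [hX]
  simp only [map_sum, map_add, map_smul, smul_eq_mul, tinner]
  refine Finset.sum_congr rfl fun i _ => ?_
  have h1 := RCLike.I_im' (X i)
  simp only [map_mul, RCLike.conj_ofReal, RCLike.conj_I, mul_add, map_add, RCLike.mul_re, RCLike.ofReal_re, RCLike.ofReal_im,
    RCLike.mul_im, map_neg, RCLike.I_re]
  ring_nf
  linear_combination (-f (Pi.single i RCLike.I)) * h1

lemma dual_exists (j0 : Fin d) (S : (Fin d → Fin n) → 𝕜) :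
    ∃ T : (Fin d → Fin n) → 𝕜, specNorm T ≤ 1 ∧ RCLike.re (tinner S T) = nucNorm S := by
  have hN0 : nucNorm (0 : (Fin d → Fin n) → 𝕜) = 0 :=
    le_antisymm (by simpa using nuc_le_sum j0 (0 : (Fin d → Fin n) → 𝕜)) (nuc_nonneg _)
  obtain ⟨f, hfS, hf⟩ : ∃ f : ((Fin d → Fin n) → 𝕜) →ₗ[ℝ] ℝ, f S = nucNorm S ∧ ∀ X, f X ≤ nucNorm X := by
    by_cases hS : S = 0
    · subst hS
      exact ⟨0, by simp [hN0], fun X => by simpa using nuc_nonneg X⟩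
    obtain ⟨g, hg1, hg2⟩ := exists_extension_of_le_sublinear
      (LinearPMap.mkSpanSingleton (K := ℝ) S (nucNorm S) hS) nucNorm
      (fun c hc x => nuc_smul_pos j0 c hc x) (fun x y => nuc_add j0 x y) (by
        rintro ⟨x, hx⟩
        obtain ⟨c, rfl⟩ := Submodule.mem_span_singleton.1 hx
        have h0 : (LinearPMap.mkSpanSingleton (K := ℝ) S (nucNorm S) hS) ⟨c • S, hx⟩ = c * nucNorm S :=
          LinearPMap.mkSpanSingleton'_apply S (nucNorm S) _ c hx
        rw [h0]
        rcases lt_trichotomy c 0 with h | h | h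
        · exact (mul_nonpos_of_nonpos_of_nonneg h.le (nuc_nonneg _)).trans (nuc_nonneg _)
        · subst h; simp [hN0]
        · exact (nuc_smul_pos j0 c h S).ge)
    refine ⟨g, ?_, hg2⟩
    have := hg1 ⟨S, Submodule.mem_span_singleton_self S⟩
    rw [this]
    exact LinearPMap.mkSpanSingleton_apply _ _ hS _
  obtain ⟨T, hT⟩ := riesz f
  refine ⟨T, spec_le _ _ zero_le_one fun x hx => ?_, by rw [← hT, hfS]⟩
  obtain ⟨c, hc, hc2⟩ : ∃ c : 𝕜, ‖c‖ = 1 ∧ c * tinner (rankOne x) T = ((‖tinner (rankOne x) T‖ : ℝ) : 𝕜) := by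
    obtain ⟨c, h1, h2⟩ := RCLike.exists_norm_eq_mul_self (tinner (rankOne x) T)
    exact ⟨c, h1, h2.symm⟩
  have h1 := hf (rankOne fun j => wt j0 c j • x j)
  have h2 := nuc_rankOne (fun j => wt j0 c j • x j)
  rw [prod_vnorm_wt, hc] at h2
  simp only [hx, Finset.prod_const_one, mul_one] at h2
  have h3 := h1.trans h2
  rw [hT, rankOne_smul, prod_wt, tinner_smul_left, hc2, RCLike.ofReal_re] at h3
  rw [tinner_norm_comm]
  exact h3

lemma sum_perm {M : Type*} [AddCommMonoid M] (ω : Equiv.Perm (Fin d)) (F : (Fin d → Fin n) → M) :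
    ∑ i : Fin d → Fin n, F (i ∘ ω) = ∑ i, F i :=
  Equiv.sum_comp (Equiv.arrowCongr ω.symm (Equiv.refl (Fin n))) F

lemma tinner_perm_rankOne (ω : Equiv.Perm (Fin d)) (T : (Fin d → Fin n) → 𝕜) (x : Fin d → Fin n → 𝕜) :
    tinner (fun i => T (i ∘ ω)) (rankOne x) = tinner T (rankOne (x ∘ ω)) := by
  unfold tinner
  rw [← sum_perm ω (fun i => T i * (starRingEnd 𝕜) (rankOne (x ∘ ω) i))]
  refine Finset.sum_congr rfl fun i _ => ?_
  have : rankOne (x ∘ ω) (i ∘ ω) = rankOne x i :=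
    Equiv.prod_comp ω (fun j => x j (i j))
  rw [this]

lemma tinner_perm_sym (ω : Equiv.Perm (Fin d)) (S T : (Fin d → Fin n) → 𝕜) (hS : IsSymT S) :
    tinner (fun i => T (i ∘ ω)) S = tinner T S := by
  unfold tinner
  rw [← sum_perm ω (fun i => T i * (starRingEnd 𝕜) (S i))]
  refine Finset.sum_congr rfl fun i _ => ?_
  rw [hS ω i]

/-- symmetrization -/
def symz (T : (Fin d → Fin n) → 𝕜) : (Fin d → Fin n) → 𝕜 :=
  ((Fintype.card (Equiv.Perm (Fin d)) : 𝕜))⁻¹ • ∑ ω : Equiv.Perm (Fin d), fun i => T (i ∘ ω)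

lemma symz_sym (T : (Fin d → Fin n) → 𝕜) : IsSymT (symz T) := by
  intro ω i
  simp only [symz, Pi.smul_apply, Finset.sum_apply]
  congr 1
  exact Equiv.sum_comp (Equiv.mulLeft ω) (fun σ : Equiv.Perm (Fin d) => T (i ∘ σ))

lemma card_perm_ne : ((Fintype.card (Equiv.Perm (Fin d)) : 𝕜)) ≠ 0 :=
  Nat.cast_ne_zero.2 Fintype.card_ne_zero

lemma dual_exists_sym (j0 : Fin d) (S : (Fin d → Fin n) → 𝕜) (hS : IsSymT S) :
    ∃ T : (Fin d → Fin n) → 𝕜, IsSymT T ∧ specNorm T ≤ 1 ∧ RCLike.re (tinner S T) = nucNorm S := by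
  obtain ⟨T, hT1, hT2⟩ := dual_exists j0 S
  have hre : RCLike.re (tinner S T) = RCLike.re (tinner T S) := by
    rw [← tinner_conj, RCLike.conj_re]
  have hts : tinner (symz T) S = tinner T S := by
    rw [symz, tinner_smul_left, tinner_sum_left]
    simp only [tinner_perm_sym _ S T hS, Finset.sum_const, Finset.card_univ, nsmul_eq_mul]
    rw [inv_mul_cancel_left₀ card_perm_ne]
  refine ⟨symz T, symz_sym T, spec_le _ _ zero_le_one fun x hx => ?_, ?_⟩
  · rw [symz, tinner_smul_left, tinner_sum_left, norm_mul, norm_inv, RCLike.norm_natCast]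
    rw [inv_mul_le_iff₀ (by exact_mod_cast Fintype.card_pos), mul_one]
    refine (norm_sum_le _ _).trans ?_
    calc _ ≤ ∑ ω : Equiv.Perm (Fin d), (1:ℝ) := Finset.sum_le_sum fun ω _ => by
            rw [tinner_perm_rankOne]
            exact (le_spec T _ fun j => hx _).trans hT1
      _ = _ := by simp
  · rw [← tinner_conj, RCLike.conj_re, hts, ← hre, hT2]

lemma expand (S T : (Fin d → Fin n) → 𝕜) (a : ℝ) :
    ∑ i, ‖T i - (a : 𝕜) * S i‖ ^ 2 = hsNorm T ^ 2 - 2 * a * RCLike.re (tinner S T) + a ^ 2 * hsNorm S ^ 2 := by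
  rw [hsNorm_sq, hsNorm_sq, tinner, map_sum, Finset.mul_sum, Finset.mul_sum, ← Finset.sum_sub_distrib, ← Finset.sum_add_distrib]
  refine Finset.sum_congr rfl fun i _ => ?_
  simp only [RCLike.norm_sq_eq_def, map_sub, RCLike.mul_re, RCLike.mul_im, RCLike.ofReal_re, RCLike.ofReal_im, RCLike.conj_re, RCLike.conj_im]
  ring

lemma hsNorm_smul (c : 𝕜) (T : (Fin d → Fin n) → 𝕜) : hsNorm (c • T) = ‖c‖ * hsNorm T := by
  unfold hsNorm
  simp only [Pi.smul_apply, smul_eq_mul, norm_mul, mul_pow]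
  rw [← Finset.mul_sum, Real.sqrt_mul (by positivity), Real.sqrt_sq (norm_nonneg _)]

lemma isSymT_smul (c : 𝕜) (T : (Fin d → Fin n) → 𝕜) (h : IsSymT T) : IsSymT (c • T) := by
  intro ω i
  simp [h ω i]

lemma entry_le (T : (Fin d → Fin n) → 𝕜) (i : Fin d → Fin n) : ‖T i‖ ≤ hsNorm T := by
  apply Real.le_sqrt_of_sq_le
  exact Finset.single_le_sum (f := fun i => ‖T i‖ ^ 2) (fun _ _ => by positivity) (Finset.mem_univ i)

lemma beta_le (S : (Fin d → Fin n) → 𝕜) (h : IsSymT S) (h1 : hsNorm S = 1) : betaSym 𝕜 n d ≤ specNorm S := by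
  refine csInf_le ⟨0, ?_⟩ ⟨S, h, h1, rfl⟩
  rintro r ⟨T, _, _, rfl⟩
  exact spec_nonneg T

lemma beta_mul_le (T : (Fin d → Fin n) → 𝕜) (h : IsSymT T) : hsNorm T * betaSym 𝕜 n d ≤ specNorm T := by
  rcases eq_or_lt_of_le (hsNorm_nonneg' T) with h0 | h0
  · rw [← h0, zero_mul]; exact spec_nonneg T
  · have hn : ‖(((hsNorm T)⁻¹ : ℝ) : 𝕜)‖ = (hsNorm T)⁻¹ := by
      rw [RCLike.norm_ofReal, abs_of_pos (inv_pos.2 h0)]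
    have h1 := beta_le ((((hsNorm T)⁻¹ : ℝ) : 𝕜) • T) (isSymT_smul _ _ h)
      (by rw [hsNorm_smul, hn, inv_mul_cancel₀ h0.ne'])
    have h2 := h1.trans (spec_smul_le _ _)
    rw [hn] at h2
    rwa [le_inv_mul_iff₀ h0] at h2

end helpers

/-- For `n, d ≥ 2`: `α'(n,d,𝕜)·β'(n,d,𝕜) = 1`, and for any symmetric
`S` with `‖S‖ = 1`, `‖S‖₁ = α'(n,d,𝕜)` iff `‖S‖_∞ = β'(n,d,𝕜)`. -/
theorem stmt5 (𝕜 : Type*) [RCLike 𝕜] (n d : ℕ) (hn : 2 ≤ n) (hd : 2 ≤ d) :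
    alphaSym 𝕜 n d * betaSym 𝕜 n d = 1 ∧
    ∀ S : (Fin d → Fin n) → 𝕜, IsSymT S → hsNorm S = 1 →
      (nucNorm S = alphaSym 𝕜 n d ↔ specNorm S = betaSym 𝕜 n d) := by
  have j0 : Fin d := ⟨0, by omega⟩
  have k0 : Fin n := ⟨0, by omega⟩
  set a := alphaSym 𝕜 n d with ha
  set b := betaSym 𝕜 n d with hb
  have hex : ∃ S : (Fin d → Fin n) → 𝕜, IsSymT S ∧ hsNorm S = 1 := by
    refine ⟨rankOne fun _ => Pi.single k0 1, ?_, ?_⟩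
    · intro ω i
      exact Equiv.prod_comp ω (fun j => (Pi.single k0 (1:𝕜) : Fin n → 𝕜) (i j))
    · rw [rankOne_single (fun _ : Fin d => k0), hsNorm, Finset.sum_eq_single (fun _ => k0)]
      · simp
      · intro i _ hi; simp [hi]
      · simp
  obtain ⟨S0, hS0, hS01⟩ := hex
  have key1 : ∀ S : (Fin d → Fin n) → 𝕜, hsNorm S = 1 → 1 ≤ nucNorm S * specNorm S := by
    intro S h
    have := tinner_le_nuc_spec j0 S S
    rw [tinner_self, h] at this
    simpa using this
  have hbdd : ∀ S : (Fin d → Fin n) → 𝕜, hsNorm S = 1 → nucNorm S ≤ Fintype.card (Fin d → Fin n) := by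
    intro S h
    refine (nuc_le_sum j0 S).trans ?_
    calc _ ≤ ∑ i : Fin d → Fin n, (1:ℝ) := Finset.sum_le_sum fun i _ => (entry_le S i).trans h.le
      _ = _ := by simp
  have hlea : ∀ S : (Fin d → Fin n) → 𝕜, IsSymT S → hsNorm S = 1 → nucNorm S ≤ a := by
    intro S h h1
    refine le_csSup ⟨Fintype.card (Fin d → Fin n), ?_⟩ ⟨S, h, h1, rfl⟩
    rintro r ⟨T, _, hT, rfl⟩
    exact hbdd T hT
  have hapos : 0 < a := by
    refine lt_of_lt_of_le ?_ (hlea S0 hS0 hS01)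
    have h := key1 S0 hS01
    rcases (nuc_nonneg S0).eq_or_lt with h0 | h0
    · rw [← h0] at h; norm_num at h
    · exact h0
  have hb1 : 1 / a ≤ b := by
    refine le_csInf ⟨_, S0, hS0, hS01, rfl⟩ ?_
    rintro r ⟨S, h, h1, rfl⟩
    rw [div_le_iff₀' hapos]
    exact (key1 S h1).trans (mul_le_mul_of_nonneg_right (hlea S h h1) (spec_nonneg S))
  have hbpos : 0 < b := lt_of_lt_of_le (by positivity) hb1
  have key2 : ∀ S : (Fin d → Fin n) → 𝕜, IsSymT S → hsNorm S = 1 → ∃ T : (Fin d → Fin n) → 𝕜,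
      specNorm T ≤ 1 ∧ nucNorm S ≤ hsNorm T ∧ hsNorm T ≤ 1 / b ∧
      ∑ i, ‖T i - (nucNorm S : 𝕜) * S i‖ ^ 2 = hsNorm T ^ 2 - nucNorm S ^ 2 := by
    intro S h h1
    obtain ⟨T, hT, hT1, hT2⟩ := dual_exists_sym j0 S h
    have he := expand S T (nucNorm S)
    rw [hT2, h1] at he
    have hnn : 0 ≤ ∑ i, ‖T i - (nucNorm S : 𝕜) * S i‖ ^ 2 := Finset.sum_nonneg fun _ _ => by positivity
    refine ⟨T, hT1, ?_, ?_, by rw [he]; ring⟩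
    · refine (sq_le_sq₀ (nuc_nonneg S) (hsNorm_nonneg' T)).1 ?_
      rw [he] at hnn
      linarith
    · rw [le_div_iff₀ hbpos]
      exact (beta_mul_le T hT).trans hT1
  have ha2 : a ≤ 1 / b := by
    refine csSup_le ⟨_, S0, hS0, hS01, rfl⟩ ?_
    rintro r ⟨S, h, h1, rfl⟩
    obtain ⟨T, -, h2, h3, -⟩ := key2 S h h1
    exact h2.trans h3
  have hab : a * b = 1 := by
    apply le_antisymm
    · rwa [le_div_iff₀ hbpos] at ha2
    · rwa [div_le_iff₀' hapos] at hb1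
  refine ⟨hab, fun S h h1 => ⟨fun hn => ?_, fun hs => ?_⟩⟩
  · apply le_antisymm _ (beta_le S h h1)
    obtain ⟨T, h2, h3, h4, h5⟩ := key2 S h h1
    have hab' : 1 / b = a := by rw [← hab]; field_simp
    rw [hn] at h3 h5
    rw [hab'] at h4
    have hTa : hsNorm T = a := le_antisymm h4 h3
    rw [hTa, sub_self, Finset.sum_eq_zero_iff_of_nonneg (fun _ _ => by positivity)] at h5
    have hST : S = (b : 𝕜) • T := by
      funext i
      have h6 := h5 i (Finset.mem_univ i)
      have h7 : T i = (a : 𝕜) * S i := by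
        rw [← sub_eq_zero, ← norm_eq_zero]
        exact pow_eq_zero_iff (two_ne_zero) |>.1 h6
      rw [Pi.smul_apply, h7, smul_eq_mul, ← mul_assoc, ← RCLike.ofReal_mul, mul_comm b a, hab]
      simp
    rw [hST]
    refine (spec_smul_le _ _).trans ?_
    rw [RCLike.norm_ofReal, abs_of_pos hbpos]
    exact mul_le_of_le_one_right hbpos.le h2
  · apply le_antisymm (hlea S h h1)
    have h2 := key1 S h1
    rw [hs, ← hab] at h2
    exact le_of_mul_le_mul_right h2 hbpos
end
end

section
/- For every d ≥ 2 and n ≥ 2, β(n^{×d}, ℝ) ≥ n^{(1-d)/2}, where n^{×d} = (n,…,n) with d entries. Moreover, for every d ≥ 3, β(2^{×d}, ℂ) ≥ (2/3)·2^{-(d-3)/2}. -/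
noncomputable section


open Complex (normSq)

def G3 (a b c : ℝ) (d u0 u1 v0 v1 w0 w1 : ℂ) : ℂ :=
  u0*v0*w0 + a*u0*v1*w1 + b*u1*v0*w1 + c*u1*v1*w0 + d*u1*v1*w1

def Bd (a b c : ℝ) (d : ℂ) : Prop := ∀ u0 u1 v0 v1 w0 w1 : ℂ,
  normSq (G3 a b c d u0 u1 v0 v1 w0 w1) ≤
    (normSq u0 + normSq u1) * (normSq v0 + normSq v1) * (normSq w0 + normSq w1)

lemma mat_bound {A B : ℂ} {C : ℝ} (hC : 0 ≤ C)
    (h : ∀ v0 v1 : ℂ, normSq (v0 * A + v1 * B) ≤ C * (normSq v0 + normSq v1)) :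
    normSq A + normSq B ≤ C := by
  have h1 := h (starRingEnd ℂ A) (starRingEnd ℂ B)
  have e : (starRingEnd ℂ A) * A + (starRingEnd ℂ B) * B = ((normSq A + normSq B : ℝ) : ℂ) := by
    rw [mul_comm, Complex.mul_conj, mul_comm, Complex.mul_conj]; push_cast; ring
  rw [e, Complex.normSq_ofReal, Complex.normSq_conj, Complex.normSq_conj] at h1
  have hA := Complex.normSq_nonneg A
  have hB := Complex.normSq_nonneg B
  by_contra hc
  push Not at hc
  nlinarith

lemma quad_lead {A B C : ℝ} (h : ∀ s : ℝ, 0 ≤ A * (s * s) + B * s + C) : 0 ≤ A := by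
  by_contra hc
  push Not at hc
  have hC : 0 ≤ C := by simpa using h 0
  have h1 := h (Real.sqrt ((C+1)/(-A)))
  have h2 := h (-Real.sqrt ((C+1)/(-A)))
  have h3 : Real.sqrt ((C+1)/(-A)) * Real.sqrt ((C+1)/(-A)) = (C+1)/(-A) :=
    Real.mul_self_sqrt (div_nonneg (by linarith) (by linarith))
  rw [neg_mul_neg, h3] at h2
  rw [h3] at h1
  have h4 : A * ((C+1)/(-A)) = -(C+1) := by
    have hne : A ≠ 0 := hc.ne
    field_simp
  linarith

lemma L1 {a b c x y : ℝ} (h : Bd a b c ⟨x, y⟩) :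
    0 ≤ 1 - a^2 - b^2 - c^2 - 2*a*b*c ∧ 0 ≤ (1-b^2)*(1-c^2) - x^2 - y^2 ∧
    (a+b*c)^2 * x^2 ≤ (1 - a^2 - b^2 - c^2 - 2*a*b*c) * ((1-b^2)*(1-c^2) - x^2 - y^2) := by
  have key : ∀ s : ℝ, 0 ≤ (1 - a^2 - b^2 - c^2 - 2*a*b*c) * (s*s) + (-2*(a+b*c)*x)*s
      + ((1-b^2)*(1-c^2) - x^2 - y^2) := by
    intro s
    have h1 : ∀ w0 w1 : ℂ, normSq (s*w0 + b*w1) + normSq (c*w0 + (a*s+⟨x,y⟩)*w1) ≤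
        (s^2+1) * (normSq w0 + normSq w1) := by
      intro w0 w1
      apply mat_bound
      · have := Complex.normSq_nonneg w0
        have := Complex.normSq_nonneg w1
        positivity
      · intro v0 v1
        have := h s 1 v0 v1 w0 w1
        have e : G3 a b c ⟨x,y⟩ s 1 v0 v1 w0 w1 =
          v0 * (s*w0 + b*w1) + v1 * (c*w0 + (a*s+⟨x,y⟩)*w1) := by unfold G3; ring
        rw [e] at this
        simp only [Complex.normSq_ofReal, map_one] at this
        nlinarith
    have h2 : ∀ p q t : ℝ, 0 ≤ (1-c^2)*(p^2+q^2) + (s^2+1-b^2-((a*s+x)^2+y^2))*t^2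
        - 2*t*(p*(s*b+c*(a*s+x)) + q*(c*y)) := by
      intro p q t
      have := h1 ⟨p,q⟩ t
      simp [Complex.normSq_apply] at this
      nlinarith
    set E := 1-c^2 with hE
    set g := s^2+1-b^2-((a*s+x)^2+y^2) with hg
    set K1 := s*b+c*(a*s+x) with hK1
    set K2 := c*y with hK2
    have hE0 : 0 ≤ E := by simpa using h2 1 0 0
    have hg0 : 0 ≤ g := by simpa using h2 0 0 1
    have h3 : ∀ t : ℝ, 0 ≤ g*(t*t) + (-2*(K1^2+K2^2))*t + E*(K1^2+K2^2) := by
      intro t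
      have := h2 K1 K2 t
      nlinarith
    have h4 := discrim_le_zero h3
    unfold discrim at h4
    have h5 : K1^2+K2^2 ≤ E*g := by
      by_contra hc
      push Not at hc
      have : 0 ≤ E*g := mul_nonneg hE0 hg0
      nlinarith [mul_pos (lt_of_le_of_lt this hc) (sub_pos.2 hc)]
    have h6 : (1 - a^2 - b^2 - c^2 - 2*a*b*c) * (s*s) + (-2*(a+b*c)*x)*s
      + ((1-b^2)*(1-c^2) - x^2 - y^2) = E*g - (K1^2+K2^2) := by
      rw [hE, hg, hK1, hK2]; ring
    linarith
  refine ⟨quad_lead key, by simpa using key 0, ?_⟩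
  have := discrim_le_zero key
  unfold discrim at this
  nlinarith

lemma Bd_swap12 {a b c : ℝ} {d : ℂ} (h : Bd a b c d) : Bd b a c d := by
  intro u0 u1 v0 v1 w0 w1
  have := h v0 v1 u0 u1 w0 w1
  convert this using 1
  · unfold G3; ring_nf
  · ring

lemma Bd_swap13 {a b c : ℝ} {d : ℂ} (h : Bd a b c d) : Bd c b a d := by
  intro u0 u1 v0 v1 w0 w1
  have := h w0 w1 v0 v1 u0 u1
  convert this using 1
  · unfold G3; ring_nf
  · ring

lemma Bd_rot {a b c x y : ℝ} (h : Bd a b c ⟨x,y⟩) : Bd (-a) b c ⟨y,-x⟩ := by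
  intro u0 u1 v0 v1 w0 w1
  have := h u0 (Complex.I*u1) v0 (-Complex.I*v1) w0 (-Complex.I*w1)
  simp only [map_mul, Complex.normSq_neg, Complex.normSq_I, one_mul] at this
  convert this using 2
  unfold G3
  have : (⟨y,-x⟩:ℂ) = -Complex.I * ⟨x,y⟩ := by apply Complex.ext <;> simp
  rw [this]
  have := Complex.I_sq
  push_cast
  linear_combination (-a*u0*v1*w1 + b*u1*v0*w1 + c*u1*v1*w0 - Complex.I*⟨x,y⟩*u1*v1*w1) * this

lemma core_ineq {A B C R : ℝ} (hA : 0 ≤ A) (hAB : A ≤ B) (hAC : A ≤ C)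
    (hs : A+B+C ≤ 1)
    (hR : R = (1-B)*(1-C)) (hPP : 0 ≤ (1-(A+B+C))^2 - 4*(A*B*C)) :
    R*(3/4-(A+B+C)) ≤ (1-(A+B+C))^2 - 4*(A*B*C) := by
  obtain ⟨s, rfl⟩ : ∃ s, A = s - B - C := ⟨A+B+C, by ring⟩
  simp only [sub_add_cancel, sub_add_eq_add_sub] at *
  have e : s - B - C + B + C = s := by ring
  simp only [e] at *
  have hR1 : R ≤ (1-s/3)^2 := by
    have : R ≤ (1-(B+C)/2)^2 := by rw [hR]; nlinarith [sq_nonneg (B-C)]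
    have : (1-(B+C)/2)^2 ≤ (1-s/3)^2 := by
      apply pow_le_pow_left₀ <;> linarith
    linarith
  have hR0 : 0 ≤ R := by rw [hR]; apply mul_nonneg <;> linarith
  rcases le_total (3/4) s with h | h
  · nlinarith
  · have hp : (s-B-C)*B*C ≤ s^3/27 := by
      have h1 : (s-B-C)*B*C ≤ (s-B-C)*((B+C)/2)^2 := by
        nlinarith [sq_nonneg (B-C)]
      have h2 : (s-B-C)*((B+C)/2)^2 ≤ s^3/27 := by
        nlinarith [mul_nonneg (show 0 ≤ s + 3/2*(B+C)/2 by linarith) (sq_nonneg (s/3-(B+C)/2)), mul_nonneg (show 0 ≤ s by linarith) (sq_nonneg (s/3-(B+C)/2)), mul_nonneg (show 0 ≤ B+C by linarith) (sq_nonneg (s/3-(B+C)/2))]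
      linarith
    have h3 : R*(3/4-s) ≤ (1-s/3)^2*(3/4-s) := mul_le_mul_of_nonneg_right hR1 (by linarith)
    have h4 : 0 ≤ (1-s)^2/4 - s^3/27 := by
      have : 0 ≤ s := by linarith
      have h5: s^3 ≤ (3/4)^3 := by gcongr
      have h6 : (1/4)^2 ≤ (1-s)^2 := by apply pow_le_pow_left₀ <;> linarith
      nlinarith
    nlinarith

lemma core_min {a b c : ℝ} {x y : ℝ} (ha : 0 ≤ a) (hb : 0 ≤ b) (hc : 0 ≤ c) (hab : a ≤ b) (hac : a ≤ c)
    (h : Bd a b c ⟨x,y⟩) : a^2+b^2+c^2+(x^2+y^2) ≤ 5/4 := by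
  obtain ⟨h1, h2, h3⟩ := L1 h
  obtain ⟨h4, h5, h6⟩ := L1 (Bd_rot h)
  have hp : 0 ≤ a*b*c := by positivity
  obtain ⟨P, hP⟩ : ∃ P, P = 1 - a^2 - b^2 - c^2 - 2*a*b*c := ⟨_, rfl⟩
  obtain ⟨P', hP'⟩ : ∃ P', P' = 1 - a^2 - b^2 - c^2 + 2*a*b*c := ⟨_, rfl⟩
  obtain ⟨R, hR⟩ : ∃ R, R = (1-b^2)*(1-c^2) := ⟨_, rfl⟩
  have e1 : (a+b*c)^2 = R - P := by rw [hR, hP]; ring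
  have e2 : (-a+b*c)^2 = R - P' := by rw [hR, hP']; ring
  have e3 : 1 - (-a)^2 - b^2 - c^2 - 2*(-a)*b*c = P' := by rw [hP']; ring
  have hcore := core_ineq (A := a^2) (B := b^2) (C := c^2) (R := R) (by positivity) (by gcongr) (by gcongr)
    (by nlinarith) hR (by have : 0 ≤ P*P' := mul_nonneg (by rw [hP]; exact h1) (by rw [← e3]; exact h4)
                          rw [hP, hP'] at this; nlinarith)
  have e4 : (1-(a^2+b^2+c^2))^2 - 4*(a^2*b^2*c^2) = P*P' := by rw [hP, hP']; ring
  rw [e4] at hcore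
  rw [e1] at h3
  rw [e2, e3] at h6
  rw [e3] at h4
  rw [← hP, ← hR] at h3
  rw [← hP] at h1
  rw [← hR] at h2 h5 h6
  have hR0 : 0 ≤ R := by nlinarith
  have hRP : P ≤ R := by nlinarith [sq_nonneg (a+b*c)]
  rcases hR0.eq_or_lt with h0 | h0
  · nlinarith [sq_nonneg x, sq_nonneg y]
  · have hy : y^2 ≤ P' := by
      have : R*y^2 ≤ R*P' := by nlinarith [mul_nonneg h4 (sq_nonneg x)]
      exact le_of_mul_le_mul_left this h0
    have hx : R*x^2 ≤ P*R - P*y^2 := by nlinarith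
    have : R*(x^2+y^2) ≤ R*(P+P') - P*P' := by
      have := mul_nonneg (sub_nonneg.2 hRP) (sub_nonneg.2 hy)
      linarith
    have : R*(x^2+y^2) ≤ R*(5/4-(a^2+b^2+c^2)) := by
      have e5 : P+P' = 2 - 2*(a^2+b^2+c^2) := by rw [hP,hP']; ring
      rw [e5] at this
      linarith
    have := le_of_mul_le_mul_left this h0
    linarith

lemma core {a b c : ℝ} {d : ℂ} (ha : 0 ≤ a) (hb : 0 ≤ b) (hc : 0 ≤ c)
    (h : Bd a b c d) : a^2+b^2+c^2+normSq d ≤ 5/4 := by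
  obtain ⟨x, y⟩ := d
  rw [Complex.normSq_apply]
  simp only
  rcases le_total a b with h1 | h1
  · rcases le_total a c with h2 | h2
    · have := core_min ha hb hc h1 h2 h
      linarith
    · have := core_min hc hb ha (h2.trans h1) h2 (Bd_swap13 h)
      linarith
  · rcases le_total b c with h2 | h2
    · have := core_min hb ha hc h1 h2 (Bd_swap12 h)
      linarith
    · have := core_min hc hb ha h2 (h2.trans h1) (Bd_swap13 h)
      linarith

lemma core_complex {a b c d : ℂ} (h : ∀ u0 u1 v0 v1 w0 w1 : ℂ,
  normSq (u0*v0*w0 + a*u0*v1*w1 + b*u1*v0*w1 + c*u1*v1*w0 + d*u1*v1*w1) ≤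
    (normSq u0 + normSq u1) * (normSq v0 + normSq v1) * (normSq w0 + normSq w1)) :
    normSq a + normSq b + normSq c + normSq d ≤ 5/4 := by
  set A := Complex.arg a
  set B := Complex.arg b
  set C := Complex.arg c
  let E : ℝ → ℂ := fun t => Complex.exp (t * Complex.I)
  have hE : ∀ t, normSq (E t) = 1 := by
    intro t; rw [Complex.normSq_eq_norm_sq, Complex.norm_exp_ofReal_mul_I]; norm_num
  have hEm : ∀ s t, E s * E t = E (s+t) := by
    intro s t; simp only [E]; rw [← Complex.exp_add]; push_cast; ring_nf
  have hE0 : E 0 = 1 := by simp [E]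
  have ha : a = ‖a‖ * E A := (Complex.norm_mul_exp_arg_mul_I a).symm
  have hb : b = ‖b‖ * E B := (Complex.norm_mul_exp_arg_mul_I b).symm
  have hc : c = ‖c‖ * E C := (Complex.norm_mul_exp_arg_mul_I c).symm
  have eA : E A * (E ((B-A-C)/2) * E ((C-A-B)/2)) = 1 := by
    rw [hEm, hEm, ← hE0]; congr 1; ring
  have eB : E B * (E ((A-B-C)/2) * E ((C-A-B)/2)) = 1 := by
    rw [hEm, hEm, ← hE0]; congr 1; ring
  have eC : E C * (E ((A-B-C)/2) * E ((B-A-C)/2)) = 1 := by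
    rw [hEm, hEm, ← hE0]; congr 1; ring
  set α := E ((A-B-C)/2) with hα
  set β := E ((B-A-C)/2) with hβ
  set γ := E ((C-A-B)/2) with hγ
  have hBd : Bd ‖a‖ ‖b‖ ‖c‖ (d*(α*β*γ)) := by
    intro u0 u1 v0 v1 w0 w1
    have := h u0 (α*u1) v0 (β*v1) w0 (γ*w1)
    simp only [map_mul normSq α, map_mul normSq β, map_mul normSq γ] at this
    rw [hα, hβ, hγ, hE, hE, hE, ← hα, ← hβ, ← hγ] at this
    simp only [one_mul] at this
    convert this using 2
    unfold G3
    have ha' : a * (β * γ) = ‖a‖ := by nth_rw 1 [ha]; rw [mul_assoc, eA, mul_one]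
    have hb' : b * (α * γ) = ‖b‖ := by nth_rw 1 [hb]; rw [mul_assoc, eB, mul_one]
    have hc' : c * (α * β) = ‖c‖ := by nth_rw 1 [hc]; rw [mul_assoc, eC, mul_one]
    rw [← ha', ← hb', ← hc']
    ring
  have := core (norm_nonneg _) (norm_nonneg _) (norm_nonneg _) hBd
  simp only [map_mul, hα, hβ, hγ, hE, mul_one] at this
  simpa only [Complex.normSq_eq_norm_sq] using this

def F3 (T : Fin 2 → Fin 2 → Fin 2 → ℂ) (x y z : Fin 2 → ℂ) : ℂ :=
  ∑ i, ∑ j, ∑ k, T i j k * x i * y j * z k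

def q2 (v : Fin 2 → ℂ) : ℝ := normSq (v 0) + normSq (v 1)

def perp (v : Fin 2 → ℂ) : Fin 2 → ℂ := ![-(starRingEnd ℂ (v 1)), starRingEnd ℂ (v 0)]

def lc (v : Fin 2 → ℂ) (u0 u1 : ℂ) : Fin 2 → ℂ := fun i => u0 * v i + u1 * perp v i

lemma q2_lc (v : Fin 2 → ℂ) (u0 u1 : ℂ) :
    q2 (lc v u0 u1) = q2 v * (normSq u0 + normSq u1) := by
  simp [q2, lc, perp, Complex.normSq_apply]; ring

lemma F3_lc1 (T) (x y z : Fin 2 → ℂ) (u0 u1 : ℂ) :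
    F3 T (lc x u0 u1) y z = u0 * F3 T x y z + u1 * F3 T (perp x) y z := by
  simp only [F3, lc, Fin.sum_univ_two]; ring

lemma F3_lc2 (T) (x y z : Fin 2 → ℂ) (u0 u1 : ℂ) :
    F3 T x (lc y u0 u1) z = u0 * F3 T x y z + u1 * F3 T x (perp y) z := by
  simp only [F3, lc, Fin.sum_univ_two]; ring

lemma F3_lc3 (T) (x y z : Fin 2 → ℂ) (u0 u1 : ℂ) :
    F3 T x y (lc z u0 u1) = u0 * F3 T x y z + u1 * F3 T x y (perp z) := by
  simp only [F3, lc, Fin.sum_univ_two]; ring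

lemma par (p r x0 x1 : ℂ) : normSq (x0*p + x1*r) +
    normSq (-(starRingEnd ℂ x1)*p + starRingEnd ℂ x0 * r)
      = (normSq x0 + normSq x1) * (normSq p + normSq r) := by
  simp [Complex.normSq_apply]; ring

lemma par1 (T) (x y z : Fin 2 → ℂ) (hx : q2 x = 1) :
    normSq (F3 T x y z) + normSq (F3 T (perp x) y z) =
      normSq (F3 T ![1,0] y z) + normSq (F3 T ![0,1] y z) := by
  have := par (F3 T ![1,0] y z) (F3 T ![0,1] y z) (x 0) (x 1)
  unfold q2 at hx
  rw [hx, one_mul] at this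
  rw [← this]
  congr 2 <;> simp [F3, perp, Fin.sum_univ_two] <;> ring

lemma par2 (T) (x y z : Fin 2 → ℂ) (hx : q2 y = 1) :
    normSq (F3 T x y z) + normSq (F3 T x (perp y) z) =
      normSq (F3 T x ![1,0] z) + normSq (F3 T x ![0,1] z) := by
  have := par (F3 T x ![1,0] z) (F3 T x ![0,1] z) (y 0) (y 1)
  unfold q2 at hx
  rw [hx, one_mul] at this
  rw [← this]
  congr 2 <;> simp [F3, perp, Fin.sum_univ_two] <;> ring

lemma par3 (T) (x y z : Fin 2 → ℂ) (hx : q2 z = 1) :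
    normSq (F3 T x y z) + normSq (F3 T x y (perp z)) =
      normSq (F3 T x y ![1,0]) + normSq (F3 T x y ![0,1]) := by
  have := par (F3 T x y ![1,0]) (F3 T x y ![0,1]) (z 0) (z 1)
  unfold q2 at hx
  rw [hx, one_mul] at this
  rw [← this]
  congr 2 <;> simp [F3, perp, Fin.sum_univ_two] <;> ring

lemma par_all (T) (x y z : Fin 2 → ℂ) (hx : q2 x = 1) (hy : q2 y = 1) (hz : q2 z = 1) :
    normSq (F3 T x y z) + normSq (F3 T (perp x) y z) + normSq (F3 T x (perp y) z)
    + normSq (F3 T x y (perp z)) + normSq (F3 T x (perp y) (perp z))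
    + normSq (F3 T (perp x) y (perp z)) + normSq (F3 T (perp x) (perp y) z)
    + normSq (F3 T (perp x) (perp y) (perp z)) = ∑ i, ∑ j, ∑ k, normSq (T i j k) := by
  have e : ∑ i, ∑ j, ∑ k, normSq (T i j k) =
    normSq (F3 T ![1,0] ![1,0] ![1,0]) + normSq (F3 T ![0,1] ![1,0] ![1,0]) +
    normSq (F3 T ![1,0] ![0,1] ![1,0]) + normSq (F3 T ![0,1] ![0,1] ![1,0]) +
    normSq (F3 T ![1,0] ![1,0] ![0,1]) + normSq (F3 T ![0,1] ![1,0] ![0,1]) +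
    normSq (F3 T ![1,0] ![0,1] ![0,1]) + normSq (F3 T ![0,1] ![0,1] ![0,1]) := by
    simp [F3, Fin.sum_univ_two]; ring
  rw [e]
  have a1 := par1 T x y z hx
  have a2 := par1 T x (perp y) z hx
  have a3 := par1 T x y (perp z) hx
  have a4 := par1 T x (perp y) (perp z) hx
  have b1 := par2 T ![1,0] y z hy
  have b2 := par2 T ![0,1] y z hy
  have b3 := par2 T ![1,0] y (perp z) hy
  have b4 := par2 T ![0,1] y (perp z) hy
  have c1 := par3 T ![1,0] ![1,0] z hz
  have c2 := par3 T ![1,0] ![0,1] z hz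
  have c3 := par3 T ![0,1] ![1,0] z hz
  have c4 := par3 T ![0,1] ![0,1] z hz
  linarith

lemma exists_max (T) : ∃ x y z : Fin 2 → ℂ, q2 x = 1 ∧ q2 y = 1 ∧ q2 z = 1 ∧
    ∀ x' y' z', q2 x' = 1 → q2 y' = 1 → q2 z' = 1 →
      normSq (F3 T x' y' z') ≤ normSq (F3 T x y z) := by
  let K : Set (Fin 2 → ℂ) := {v | q2 v = 1}
  have hq : Continuous q2 := by
    unfold q2
    have := Complex.continuous_normSq
    fun_prop
  have hK : IsCompact K := by
    apply Metric.isCompact_of_isClosed_isBounded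
    · exact isClosed_eq hq continuous_const
    · rw [isBounded_iff_forall_norm_le]
      refine ⟨1, fun v hv => ?_⟩
      have hv : normSq (v 0) + normSq (v 1) = 1 := hv
      rw [Complex.normSq_eq_norm_sq, Complex.normSq_eq_norm_sq] at hv
      rw [pi_norm_le_iff_of_nonneg zero_le_one, Fin.forall_fin_two]
      constructor <;> nlinarith [norm_nonneg (v 0), norm_nonneg (v 1)]
  have hne : (K ×ˢ (K ×ˢ K)).Nonempty :=
    ⟨(![1,0],![1,0],![1,0]), by simp [K, q2]⟩
  obtain ⟨⟨x,y,z⟩, ⟨hx, hy, hz⟩, hm⟩ := (hK.prod (hK.prod hK)).exists_isMaxOn hne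
    (f := fun p => normSq (F3 T p.1 p.2.1 p.2.2)) (by
      apply Continuous.continuousOn
      apply Complex.continuous_normSq.comp
      unfold F3
      fun_prop)
  exact ⟨x, y, z, hx, hy, hz, fun x' y' z' h1 h2 h3 => hm (a := (x',y',z')) ⟨h1, h2, h3⟩⟩

lemma q2_normalize (v : Fin 2 → ℂ) : ∃ (r : ℝ) (v' : Fin 2 → ℂ), q2 v' = 1 ∧ (∀ i, v i = r * v' i) ∧
    r^2 = q2 v := by
  have h0 : 0 ≤ q2 v := add_nonneg (Complex.normSq_nonneg _) (Complex.normSq_nonneg _)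
  rcases h0.eq_or_lt with h | h
  · refine ⟨0, ![1,0], by simp [q2], ?_, by rw [← h]; norm_num⟩
    unfold q2 at h
    have h1 := Complex.normSq_nonneg (v 0)
    have h2 := Complex.normSq_nonneg (v 1)
    have h3 : v 0 = 0 := Complex.normSq_eq_zero.1 (by linarith)
    have h4 : v 1 = 0 := Complex.normSq_eq_zero.1 (by linarith)
    rw [Fin.forall_fin_two]; simp [h3, h4]
  · have hs : 0 < Real.sqrt (q2 v) := Real.sqrt_pos.2 h
    refine ⟨Real.sqrt (q2 v), fun i => ((Real.sqrt (q2 v))⁻¹ : ℝ) * v i, ?_, ?_, Real.sq_sqrt h0⟩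
    · have : q2 (fun i => ((Real.sqrt (q2 v))⁻¹ : ℝ) * v i) = ((Real.sqrt (q2 v))^2)⁻¹ * q2 v := by
        simp only [q2, map_mul, Complex.normSq_ofReal]; ring
      rw [this, Real.sq_sqrt h0, inv_mul_cancel₀ h.ne']
    · intro i
      rw [← mul_assoc, ← Complex.ofReal_mul, mul_inv_cancel₀ hs.ne']; simp

lemma three (T : Fin 2 → Fin 2 → Fin 2 → ℂ) : ∃ x y z : Fin 2 → ℂ, q2 x = 1 ∧ q2 y = 1 ∧ q2 z = 1 ∧
    4/9 * ∑ i, ∑ j, ∑ k, normSq (T i j k) ≤ normSq (F3 T x y z) := by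
  obtain ⟨x, y, z, hx, hy, hz, hm⟩ := exists_max T
  refine ⟨x, y, z, hx, hy, hz, ?_⟩
  have hb : ∀ x' y' z', normSq (F3 T x' y' z') ≤ normSq (F3 T x y z) * (q2 x' * q2 y' * q2 z') := by
    intro x' y' z'
    obtain ⟨r1, u, hu, h1, e1⟩ := q2_normalize x'
    obtain ⟨r2, v, hv, h2, e2⟩ := q2_normalize y'
    obtain ⟨r3, w, hw, h3, e3⟩ := q2_normalize z'
    have e : F3 T x' y' z' = ((r1*r2*r3 : ℝ) : ℂ) * F3 T u v w := by
      simp only [F3, Fin.sum_univ_two, h1, h2, h3]; push_cast; ring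
    rw [e, map_mul, Complex.normSq_ofReal, ← e1, ← e2, ← e3]
    have := hm u v w hu hv hw
    calc _ ≤ r1*r2*r3*(r1*r2*r3) * normSq (F3 T x y z) :=
          mul_le_mul_of_nonneg_left this (mul_self_nonneg _)
      _ = _ := by ring
  have hμ := Complex.normSq_nonneg (F3 T x y z)
  have hB : ∀ B : ℂ, (∀ v0 v1 : ℂ, normSq (v0 * F3 T x y z + v1 * B) ≤
      normSq (F3 T x y z) * (normSq v0 + normSq v1)) → B = 0 := by
    intro B h
    have h1 := mat_bound hμ h
    have h2 := Complex.normSq_nonneg B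
    exact Complex.normSq_eq_zero.1 (by linarith)
  have z1 : F3 T (perp x) y z = 0 := hB _ fun v0 v1 => by
    have := hb (lc x v0 v1) y z
    rwa [F3_lc1, q2_lc, hx, hy, hz, one_mul, mul_one, mul_one] at this
  have z2 : F3 T x (perp y) z = 0 := hB _ fun v0 v1 => by
    have := hb x (lc y v0 v1) z
    rwa [F3_lc2, q2_lc, hx, hy, hz, one_mul, one_mul, mul_one] at this
  have z3 : F3 T x y (perp z) = 0 := hB _ fun v0 v1 => by
    have := hb x y (lc z v0 v1)
    rwa [F3_lc3, q2_lc, hx, hy, hz, one_mul, one_mul, one_mul] at this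
  have hpar := par_all T x y z hx hy hz
  rw [z1, z2, z3] at hpar
  set μ := F3 T x y z with hμd
  by_cases h0 : μ = 0
  · have : ∀ x' y' z', normSq (F3 T x' y' z') = 0 := fun x' y' z' => by
      have := hb x' y' z'
      rw [h0] at this
      simp only [map_zero, zero_mul] at this
      exact le_antisymm this (Complex.normSq_nonneg _)
    simp only [this, h0, map_zero, add_zero] at hpar
    rw [← hpar, h0]; simp
  · have hpos : 0 < normSq μ := Complex.normSq_pos.2 h0
    have := core_complex (a := F3 T x (perp y) (perp z) / μ) (b := F3 T (perp x) y (perp z) / μ)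
      (c := F3 T (perp x) (perp y) z / μ) (d := F3 T (perp x) (perp y) (perp z) / μ) (by
        intro u0 u1 v0 v1 w0 w1
        have h := hb (lc x u0 u1) (lc y v0 v1) (lc z w0 w1)
        simp only [q2_lc, hx, hy, hz, one_mul] at h
        simp only [F3_lc1, F3_lc2, F3_lc3, z1, z2, z3, ← hμd] at h
        refine le_of_mul_le_mul_left ?_ hpos
        refine le_trans (le_of_eq ?_) h
        rw [← map_mul]
        congr 1
        field_simp
        ring)
    simp only [Complex.normSq_div] at this
    rw [← add_div, ← add_div, ← add_div, div_le_iff₀ hpos] at this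
    simp only [map_zero, add_zero] at hpar
    rw [← hpar]
    linarith

def Good (𝕜 : Type*) [RCLike 𝕜] (d n : ℕ) (c : ℝ) : Prop :=
  ∀ T : (Fin d → Fin n) → 𝕜, ∃ x : Fin d → Fin n → 𝕜, (∀ j, vnorm (x j) = 1) ∧
    c * ∑ i, ‖T i‖^2 ≤ ‖tinner T (rankOne x)‖^2

lemma sum_cons {M : Type*} [AddCommMonoid M] {d n : ℕ} (f : (Fin (d+1) → Fin n) → M) :
    ∑ i, f i = ∑ k : Fin n, ∑ i : Fin d → Fin n, f (Fin.cons k i) := by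
  rw [← (Fin.consEquiv (fun _ => Fin n)).sum_comp, Fintype.sum_prod_type]
  rfl

lemma good_step {𝕜 : Type*} [RCLike 𝕜] {d n : ℕ} (hn : 1 ≤ n) {c : ℝ} (hc : 0 ≤ c)
    (h : Good 𝕜 d n c) : Good 𝕜 (d+1) n (c / n) := by
  intro T
  obtain ⟨k, hk⟩ : ∃ k : Fin n, (∑ i, ‖T i‖^2) / n ≤ ∑ i : Fin d → Fin n, ‖T (Fin.cons k i)‖^2 := by
    haveI : Nonempty (Fin n) := ⟨⟨0, hn⟩⟩
    have : ∑ k : Fin n, (∑ i, ‖T i‖^2) / (n:ℝ) ≤ ∑ k : Fin n, ∑ i : Fin d → Fin n, ‖T (Fin.cons k i)‖^2 := by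
      rw [← sum_cons (fun i => ‖T i‖^2)]
      have : (n:ℝ) ≠ 0 := by positivity
      simp only [Finset.sum_const, Finset.card_univ, Fintype.card_fin, nsmul_eq_mul]
      rw [mul_div_cancel₀ _ this]
    obtain ⟨k, -, hk⟩ := Finset.exists_le_of_sum_le Finset.univ_nonempty this
    exact ⟨k, hk⟩
  obtain ⟨x, hx, hxT⟩ := h (fun i => T (Fin.cons k i))
  refine ⟨Fin.cons (Pi.single k 1) x, ?_, ?_⟩
  · intro j
    refine Fin.cases ?_ (fun j => ?_) j
    · simp only [Fin.cons_zero, vnorm]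
      rw [Finset.sum_eq_single k] <;> simp +contextual [Pi.single_apply]
    · simpa using hx j
  · have e : tinner T (rankOne (Fin.cons (Pi.single k 1) x)) =
        tinner (fun i => T (Fin.cons k i)) (rankOne x) := by
      unfold tinner
      rw [sum_cons, Finset.sum_eq_single k]
      · refine Finset.sum_congr rfl fun i _ => ?_
        simp [rankOne, Fin.prod_univ_succ]
      · intro b _ hb
        refine Finset.sum_eq_zero fun i _ => ?_
        simp [rankOne, Fin.prod_univ_succ, Pi.single_apply, hb]
      · simp
    rw [e]
    refine le_trans ?_ hxT
    calc _ = c * ((∑ i, ‖T i‖^2) / n) := by ring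
      _ ≤ _ := mul_le_mul_of_nonneg_left hk hc

lemma good_one {n : ℕ} (hn : 1 ≤ n) : Good ℝ 1 n 1 := by
  intro T
  let t : Fin n → ℝ := fun k => T (fun _ => k)
  have hsum : ∀ f : (Fin 1 → Fin n) → ℝ, ∑ i, f i = ∑ k, f (fun _ => k) := by
    intro f
    rw [← (Equiv.funUnique (Fin 1) (Fin n)).symm.sum_comp]
    rfl
  have hti : ∀ v : Fin n → ℝ, tinner T (rankOne (fun _ => v)) = ∑ k, t k * v k := by
    intro v
    unfold tinner
    rw [hsum]
    simp [rankOne, t]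
  have hS : ∑ i, ‖T i‖^2 = ∑ k, t k ^ 2 := by
    rw [hsum]; simp [t]
  rw [hS]
  have h0 : 0 ≤ ∑ k, t k ^ 2 := Finset.sum_nonneg fun _ _ => sq_nonneg _
  rcases h0.eq_or_lt with h | h
  · refine ⟨fun _ => Pi.single ⟨0, hn⟩ 1, fun j => ?_, by rw [← h, mul_zero]; positivity⟩
    simp only [vnorm]
    rw [Finset.sum_eq_single ⟨0, hn⟩] <;> simp +contextual [Pi.single_apply]
  · have hs := Real.sqrt_pos.2 h
    have hss := Real.sq_sqrt h0
    set s := Real.sqrt (∑ k, t k ^ 2) with hsd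
    refine ⟨fun _ k => t k / s, fun j => ?_, ?_⟩
    · simp only [vnorm, Real.norm_eq_abs, sq_abs, div_pow]
      rw [← Finset.sum_div, hss, div_self h.ne', Real.sqrt_one]
    · rw [hti]
      have : ∑ k, t k * (t k / s) = s := by
        rw [show ∑ k, t k * (t k / s) = (∑ k, t k ^ 2) / s by
          rw [Finset.sum_div]; exact Finset.sum_congr rfl fun k _ => by ring]
        rw [← hss]; field_simp
      rw [this, Real.norm_eq_abs, sq_abs, hss, one_mul]

lemma good_three : Good ℂ 3 2 (4/9) := by
  intro T
  obtain ⟨x, y, z, hx, hy, hz, h⟩ := three (fun i j k => T ![i,j,k])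
  let c : (Fin 2 → ℂ) → Fin 2 → ℂ := fun v i => starRingEnd ℂ (v i)
  have hv : ∀ v, q2 v = 1 → vnorm (c v) = 1 := by
    intro v hv
    simp only [vnorm, c, Fin.sum_univ_two, RCLike.norm_conj]
    rw [← Complex.normSq_eq_norm_sq, ← Complex.normSq_eq_norm_sq]
    unfold q2 at hv
    rw [hv, Real.sqrt_one]
  have hs : ∀ {M : Type} [AddCommMonoid M] (f : (Fin 3 → Fin 2) → M),
      ∑ i, f i = ∑ i, ∑ j, ∑ k, f ![i,j,k] := by
    intro M _ f
    rw [sum_cons]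
    refine Finset.sum_congr rfl fun i _ => ?_
    rw [sum_cons]
    refine Finset.sum_congr rfl fun j _ => ?_
    rw [sum_cons]
    refine Finset.sum_congr rfl fun k _ => ?_
    rw [Fintype.sum_unique]
    congr 1
  refine ⟨![c x, c y, c z], ?_, ?_⟩
  · intro j
    fin_cases j
    · exact hv x hx
    · exact hv y hy
    · exact hv z hz
  · have e : tinner T (rankOne ![c x, c y, c z]) = F3 (fun i j k => T ![i,j,k]) x y z := by
      unfold tinner F3
      rw [hs]
      refine Finset.sum_congr rfl fun i _ => Finset.sum_congr rfl fun j _ =>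
        Finset.sum_congr rfl fun k _ => ?_
      simp [rankOne, Fin.prod_univ_three, c]
      ring
    rw [e, hs]
    simpa only [Complex.normSq_eq_norm_sq] using h

lemma good_beta {𝕜 : Type*} [RCLike 𝕜] {d n : ℕ} (hn : 1 ≤ n) {c : ℝ}
    (h : Good 𝕜 d n (c^2)) : c ≤ betaN 𝕜 d n := by
  unfold betaN
  apply le_csInf
  · let i0 : Fin d → Fin n := fun _ => ⟨0, hn⟩
    refine ⟨_, Pi.single i0 1, ?_, rfl⟩
    unfold hsNorm
    rw [Finset.sum_eq_single i0] <;> simp +contextual [Pi.single_apply]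
  · rintro r ⟨T, hT, rfl⟩
    obtain ⟨x, hx, hxT⟩ := h T
    have hT' : ∑ i, ‖T i‖^2 = 1 := by
      unfold hsNorm at hT
      exact Real.sqrt_eq_one.1 hT
    rw [hT', mul_one] at hxT
    have h1 : c ≤ ‖tinner T (rankOne x)‖ := le_of_sq_le_sq hxT (norm_nonneg _)
    refine h1.trans (le_csSup ?_ ⟨x, hx, rfl⟩)
    refine ⟨∑ i, ‖T i‖, ?_⟩
    rintro r ⟨x, hx, rfl⟩
    unfold tinner
    refine (norm_sum_le _ _).trans (Finset.sum_le_sum fun i _ => ?_)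
    rw [norm_mul, RCLike.norm_conj]
    have : ‖rankOne x i‖ ≤ 1 := by
      unfold rankOne
      rw [norm_prod]
      apply Finset.prod_le_one
      · intros; positivity
      · intro j _
        have hj := Real.sqrt_eq_one.1 (hx j)
        have := Finset.single_le_sum (f := fun k => ‖x j k‖^2) (fun _ _ => sq_nonneg _)
          (Finset.mem_univ (i j))
        rw [hj] at this
        have h0 := norm_nonneg (x j (i j))
        nlinarith
    exact mul_le_of_le_one_right (norm_nonneg _) this

lemma good_iter {𝕜 : Type*} [RCLike 𝕜] {d n : ℕ} (hn : 1 ≤ n) {c : ℝ} (hc : 0 ≤ c)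
    (h : Good 𝕜 d n c) (m : ℕ) : Good 𝕜 (d+m) n (c / (n:ℝ)^m) := by
  induction m with
  | zero => simpa using h
  | succ m ih =>
    have := good_step hn (by positivity) ih
    rwa [div_div, ← pow_succ] at this

/-- `β(n^{×d},ℝ) ≥ n^{(1-d)/2}` for `d, n ≥ 2`, and
`β(2^{×d},ℂ) ≥ (2/3)·2^{-(d-3)/2}` for `d ≥ 3`. -/
theorem stmt16 :
    (∀ d n : ℕ, 2 ≤ d → 2 ≤ n →
      (n : ℝ) ^ ((1 - (d : ℝ)) / 2) ≤ betaN ℝ d n) ∧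
    (∀ d : ℕ, 3 ≤ d →
      (2 / 3 : ℝ) * (2 : ℝ) ^ (-((d : ℝ) - 3) / 2) ≤ betaN ℂ d 2) := by
  have key : ∀ (n : ℝ) (m : ℕ), 0 < n → (n ^ (-(m:ℝ)/2))^2 = 1 / n^m := by
    intro n m hn
    rw [← Real.rpow_natCast, ← Real.rpow_mul hn.le]
    rw [show -(m:ℝ)/2 * ((2:ℕ):ℝ) = -(m:ℝ) by push_cast; ring, Real.rpow_neg hn.le,
      Real.rpow_natCast, one_div]
  constructor
  · intro d n hd hn
    obtain ⟨m, rfl⟩ := Nat.exists_eq_add_of_le (show 1 ≤ d by omega)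
    apply good_beta (by omega)
    rw [show (1 - ((1+m : ℕ):ℝ))/2 = -(m:ℝ)/2 by push_cast; ring, key _ _ (by positivity)]
    exact good_iter (by omega) zero_le_one (good_one (by omega)) m
  · intro d hd
    obtain ⟨m, rfl⟩ := Nat.exists_eq_add_of_le hd
    apply good_beta (by omega)
    rw [show -(((3+m : ℕ):ℝ) - 3)/2 = -(m:ℝ)/2 by push_cast; ring, mul_pow, key _ _ (by positivity)]
    have := good_iter (by omega) (by norm_num) good_three m
    convert this using 1
    push_cast
    ring
end
end
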